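/- Let n, m ≥ 2, let P = (F, r) be a facet-bipartite n-polytope with coloring c and base flag Φ₀ satisfying c(Φ₀) = 0, and let Q = (G, s) be a vertex-bipartite m-polytope with coloring d and base flag Ψ₀ satisfying d(Ψ₀) = 0, and let M be the flag set of the flat amalgamation P|Q. Let H be the set of pairs (φ, ψ) with φ an automorphism of P and ψ an automorphism of Q such that c(φ(Λ)) + d(ψ(Δ)) = c(Λ) + d(Δ) for all Λ ∈ F and Δ ∈ G (i.e. φ preserves the coloring c if and only if ψ preserves the coloring d). Then H is a subgroup of Γ(P) × Γ(Q), for each (φ, ψ) ∈ H the map (Λ, Δ) ↦ (φ(Λ), ψ(Δ)) maps M to M and restricts to an automorphism of P|Q, and the resulting map H → Γ(P|Q) is a group isomorphism. -/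

import Mathlib

/-- `SOrbit r S Φ Ψ` : the flag `Ψ` lies in the orbit of the flag `Φ` under the
subgroup generated by the involutions `r c` for `c ∈ S`. -/
def SOrbit {F : Type*} (r : ℕ → F → F) (S : Set ℕ) (Φ Ψ : F) : Prop :=
  Relation.ReflTransGen (fun x y => ∃ i ∈ S, r i x = y) Φ Ψ

/-- Encoding of an abstract `n`-polytope on a flag set `F` with maps `r i`
(only the indices `i < n` are relevant). -/
structure IsPolytope (n : ℕ) {F : Type*} (r : ℕ → F → F) : Prop where
  nonempty : Nonempty F
  invol : ∀ i < n, ∀ Φ, r i (r i Φ) = Φ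
  noFixedPoints : ∀ i < n, ∀ Φ, r i Φ ≠ Φ
  commute : ∀ i < n, ∀ j < n, i + 1 < j → ∀ Φ, r i (r j Φ) = r j (r i Φ)
  transitive : ∀ Φ Ψ, SOrbit r {c | c < n} Φ Ψ
  pip : ∀ i j, i < j → j < n → ∀ Φ Ψ,
    SOrbit r {c | i ≤ c ∧ c < n} Φ Ψ → SOrbit r {c | c ≤ j} Φ Ψ →
    SOrbit r {c | i ≤ c ∧ c ≤ j} Φ Ψ

/-- `(i,j)`-flatness: the `({0,…,n−1} \ {i})`-orbit of any flag meets the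
`({0,…,n−1} \ {j})`-orbit of any flag. -/
def IsFlat (n : ℕ) {F : Type*} (r : ℕ → F → F) (i j : ℕ) : Prop :=
  ∀ Φ Ψ : F, ∃ Λ, SOrbit r ({c | c < n} \ {i}) Φ Λ ∧ SOrbit r ({c | c < n} \ {j}) Ψ Λ


/-- The maps `R_0, …, R_{m+n−2}` of the mix construction on `F × G`
(here `n` is the rank of the first factor):
`R_i(Λ, Δ) = (r_i Λ, Δ)` for `i ≤ n−2`, `R_{n−1}(Λ, Δ) = (r_{n−1} Λ, s_0 Δ)`, and
`R_i(Λ, Δ) = (Λ, s_{i−n+1} Δ)` for `i ≥ n`. -/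
def mixR {F G : Type*} (n : ℕ) (r : ℕ → F → F) (s : ℕ → G → G) :
    ℕ → F × G → F × G :=
  fun i X =>
    if i < n - 1 then (r i X.1, X.2)
    else if i = n - 1 then (r (n - 1) X.1, s 0 X.2)
    else (X.1, s (i - n + 1) X.2)

/-- The flag set `M` of the flat amalgamation: the orbit of the base flag `(Φ₀, Ψ₀)`
under the group generated by the maps `R_0, …, R_{m+n−2}` of the mix construction. -/
def mixM {F G : Type*} (n m : ℕ) (r : ℕ → F → F) (s : ℕ → G → G)
    (Φ₀ : F) (Ψ₀ : G) : Set (F × G) :=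
  {X | SOrbit (mixR n r s) {c | c < m + n - 1} (Φ₀, Ψ₀) X}

/-- An automorphism of the structure with maps `r_0, …, r_{n−1}` on flag set `F`:
a bijection commuting with each `r_i`, `i < n`. -/
def IsAuto (n : ℕ) {F : Type*} (r : ℕ → F → F) (φ : F → F) : Prop :=
  Function.Bijective φ ∧ ∀ i < n, ∀ Φ, φ (r i Φ) = r i (φ Φ)

/-- An automorphism of the restriction of the structure with maps `R_0, …, R_{N−1}`
to the invariant flag set `M`: a bijection of `M` commuting with each `R_i` on `M`. -/
def IsAutoOn {T : Type*} (N : ℕ) (R : ℕ → T → T) (M : Set T) (g : T → T) : Prop :=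
  Set.BijOn g M M ∧ ∀ i < N, ∀ X ∈ M, g (R i X) = R i (g X)

/-- The set `H` of pairs `(φ, ψ)` of automorphisms of `P` and `Q` such that `φ`
preserves the coloring `c` if and only if `ψ` preserves the coloring `d`. -/
def mixH {F G : Type*} (n m : ℕ) (r : ℕ → F → F) (s : ℕ → G → G)
    (c : F → ZMod 2) (d : G → ZMod 2) : Set ((F → F) × (G → G)) :=
  {p | IsAuto n r p.1 ∧ IsAuto m s p.2 ∧
    ∀ (Λ : F) (Δ : G), c (p.1 Λ) + d (p.2 Δ) = c Λ + d Δ}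

theorem poly_ind {F : Type*} {n : ℕ} {r : ℕ → F → F} (hP : IsPolytope n r) (p : F → Prop) (x : F)
    (hx : p x) (h : ∀ i < n, ∀ y, p y → p (r i y)) (y : F) : p y := by
  have := hP.transitive x y
  unfold SOrbit at this
  induction this with
  | refl => exact hx
  | tail _ hs ih =>
    obtain ⟨i, hi, rfl⟩ := hs
    exact h i hi _ ih

theorem mixR_lo {F G : Type*} {n : ℕ} (r : ℕ → F → F) (s : ℕ → G → G) {i : ℕ} (hi : i < n - 1)
    (a : F) (b : G) : mixR n r s i (a, b) = (r i a, b) := by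
  simp [mixR, hi]

theorem mixR_mid {F G : Type*} {n : ℕ} (r : ℕ → F → F) (s : ℕ → G → G)
    (a : F) (b : G) : mixR n r s (n - 1) (a, b) = (r (n - 1) a, s 0 b) := by
  simp [mixR]

theorem mixR_hi {F G : Type*} {n : ℕ} (hn : 2 ≤ n) (r : ℕ → F → F) (s : ℕ → G → G) {j : ℕ}
    (hj : 1 ≤ j) (a : F) (b : G) : mixR n r s (n - 1 + j) (a, b) = (a, s j b) := by
  have h1 : ¬ (n - 1 + j < n - 1) := by omega
  have h2 : ¬ (n - 1 + j = n - 1) := by omega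
  have h3 : n - 1 + j - n + 1 = j := by omega
  simp only [mixR, h1, h2, h3, if_false]

theorem idx_cases {n m i : ℕ} (hn : 2 ≤ n) (hi : i < m + n - 1) :
    i < n - 1 ∨ i = n - 1 ∨ ∃ j, 1 ≤ j ∧ j < m ∧ i = n - 1 + j := by
  rcases lt_trichotomy i (n - 1) with h | h | h
  · exact Or.inl h
  · exact Or.inr (Or.inl h)
  · exact Or.inr (Or.inr ⟨i - (n - 1), by omega, by omega, by omega⟩)

theorem z1 : ∀ a b : ZMod 2, a ≠ b → a = b + 1 := by decide
theorem z2 : ∀ a b : ZMod 2, a ≠ b → a + 1 = b := by decide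
theorem z3 : ∀ a b : ZMod 2, a + 1 = b → a ≠ b := by decide
theorem z4 : ∀ a b : ZMod 2, a + 1 ≠ b → a = b := by decide
theorem z5 : ∀ a b x y : ZMod 2, a + b = x + y → (a = b ↔ x = y) := by decide
theorem z6 : ∀ a b : ZMod 2, a = b → a + b = 0 := by decide
theorem z7 : ∀ a b x y : ZMod 2, a + 1 = b → x + 1 = y → a + b = x + y := by decide

/-- Color data bundled in the form used below. -/
theorem mem_mixM {F G : Type*} (n m : ℕ) (hn : 2 ≤ n) (hm : 2 ≤ m)
    (r : ℕ → F → F) (hP : IsPolytope n r) (c : F → ZMod 2)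
    (hc : ∀ i < n - 1, ∀ Λ, c (r i Λ) = c Λ) (hc' : ∀ Λ, c (r (n - 1) Λ) = c Λ + 1)
    (Φ₀ : F) (hΦ₀ : c Φ₀ = 0)
    (s : ℕ → G → G) (hQ : IsPolytope m s) (d : G → ZMod 2)
    (hd : ∀ j, 1 ≤ j → j < m → ∀ Δ, d (s j Δ) = d Δ) (hd' : ∀ Δ, d (s 0 Δ) = d Δ + 1)
    (Ψ₀ : G) (hΨ₀ : d Ψ₀ = 0) (a : F) (b : G) :
    (a, b) ∈ mixM n m r s Φ₀ Ψ₀ ↔ c a = d b := by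
  constructor
  · intro h
    have key : ∀ X, SOrbit (mixR n r s) {c | c < m + n - 1} (Φ₀, Ψ₀) X → c X.1 = d X.2 := by
      intro X hX
      unfold SOrbit at hX
      induction hX with
      | refl => simp [hΦ₀, hΨ₀]
      | @tail Y Z _ hs ih =>
        obtain ⟨i, hi, rfl⟩ := hs
        obtain ⟨y, z⟩ := Y
        rcases idx_cases hn hi with h | rfl | ⟨j, h1, h2, rfl⟩
        · rw [mixR_lo r s h]; simpa [hc i h] using ih
        · rw [mixR_mid]; simpa [hc', hd'] using ih
        · rw [mixR_hi hn r s h1]; simpa [hd j h1 h2] using ih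
    exact key _ h
  · have step : ∀ i < m + n - 1, ∀ X, X ∈ mixM n m r s Φ₀ Ψ₀ →
        mixR n r s i X ∈ mixM n m r s Φ₀ Ψ₀ := fun i hi X hX =>
      Relation.ReflTransGen.tail hX ⟨i, hi, rfl⟩
    have lo : ∀ i < n - 1, ∀ x y, (x, y) ∈ mixM n m r s Φ₀ Ψ₀ →
        (r i x, y) ∈ mixM n m r s Φ₀ Ψ₀ := fun i hi x y h => by
      have := step i (by omega) _ h
      rwa [mixR_lo r s hi] at this
    have mid : ∀ x y, (x, y) ∈ mixM n m r s Φ₀ Ψ₀ →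
        (r (n - 1) x, s 0 y) ∈ mixM n m r s Φ₀ Ψ₀ := fun x y h => by
      have := step (n - 1) (by omega) _ h
      rwa [mixR_mid] at this
    have hi' : ∀ j, 1 ≤ j → j < m → ∀ x y, (x, y) ∈ mixM n m r s Φ₀ Ψ₀ →
        (x, s j y) ∈ mixM n m r s Φ₀ Ψ₀ := fun j h1 h2 x y h => by
      have := step (n - 1 + j) (by omega) _ h
      rwa [mixR_hi hn r s h1] at this
    have A : ∀ x, (c x = 0 → (x, Ψ₀) ∈ mixM n m r s Φ₀ Ψ₀) ∧
        (c x ≠ 0 → (x, s 0 Ψ₀) ∈ mixM n m r s Φ₀ Ψ₀) := by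
      refine poly_ind hP _ Φ₀ ?_ ?_
      · exact ⟨fun _ => Relation.ReflTransGen.refl, fun h => absurd hΦ₀ h⟩
      · intro i hi x hx
        rcases (show i < n - 1 ∨ i = n - 1 by omega) with h | rfl
        · rw [hc i h]
          exact ⟨fun h' => lo i h _ _ (hx.1 h'), fun h' => lo i h _ _ (hx.2 h')⟩
        · rw [hc']
          refine ⟨fun h' => ?_, fun h' => mid _ _ (hx.1 (z4 _ _ h'))⟩
          have := mid _ _ (hx.2 (z3 _ _ h'))
          rwa [hQ.invol 0 (by omega)] at this
    have B : ∀ y, (d y = c a → (a, y) ∈ mixM n m r s Φ₀ Ψ₀) ∧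
        (d y ≠ c a → (r (n - 1) a, y) ∈ mixM n m r s Φ₀ Ψ₀) := by
      refine poly_ind hQ _ Ψ₀ ?_ ?_
      · rw [hΨ₀]
        refine ⟨fun h => (A a).1 h.symm, fun h => (A _).1 ?_⟩
        rw [hc']; exact z2 _ _ h.symm
      · intro i hi y hy
        rcases (show 1 ≤ i ∨ i = 0 by omega) with h | rfl
        · rw [hd i h hi]
          exact ⟨fun h' => hi' i h hi _ _ (hy.1 h'), fun h' => hi' i h hi _ _ (hy.2 h')⟩
        · rw [hd']
          refine ⟨fun h' => ?_, fun h' => mid _ _ (hy.1 (z4 _ _ h'))⟩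
          have := mid _ _ (hy.2 (z3 _ _ h'))
          rwa [hP.invol (n - 1) (by omega)] at this
    exact fun h => (B b).1 h.symm

/-- Every map commuting with the mixed generators splits as a product. -/
theorem split_core {F G : Type*} (n m : ℕ) (hn : 2 ≤ n) (hm : 2 ≤ m)
    (r : ℕ → F → F) (hP : IsPolytope n r) (c : F → ZMod 2)
    (hc : ∀ i < n - 1, ∀ Λ, c (r i Λ) = c Λ) (hc' : ∀ Λ, c (r (n - 1) Λ) = c Λ + 1)
    (s : ℕ → G → G) (hQ : IsPolytope m s) (d : G → ZMod 2)
    (hd : ∀ j, 1 ≤ j → j < m → ∀ Δ, d (s j Δ) = d Δ) (hd' : ∀ Δ, d (s 0 Δ) = d Δ + 1)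
    (ex1 : ∀ a, ∃ b, c a = d b) (ex2 : ∀ b, ∃ a, c a = d b)
    (g : F × G → F × G)
    (lo : ∀ i < n - 1, ∀ a b, c a = d b → g (r i a, b) = (r i (g (a, b)).1, (g (a, b)).2))
    (mid : ∀ a b, c a = d b →
      g (r (n - 1) a, s 0 b) = (r (n - 1) (g (a, b)).1, s 0 (g (a, b)).2))
    (hi' : ∀ j, 1 ≤ j → j < m → ∀ a b, c a = d b →
      g (a, s j b) = ((g (a, b)).1, s j (g (a, b)).2)) :
    ∃ (φ : F → F) (ψ : G → G), (∀ i < n, ∀ x, φ (r i x) = r i (φ x)) ∧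
      (∀ i < m, ∀ x, ψ (s i x) = s i (ψ x)) ∧ ∀ a b, c a = d b → g (a, b) = (φ a, ψ b) := by
  choose u hu using ex1
  choose v hv using ex2
  have B : ∀ a b b', c a = d b → c a = d b' → (g (a, b')).1 = (g (a, b)).1 := by
    intro a b b' h h'
    have : ∀ y, (d y = c a → (g (a, y)).1 = (g (a, b)).1) ∧
        (d y ≠ c a → (g (r (n - 1) a, y)).1 = r (n - 1) (g (a, b)).1) := by
      refine poly_ind hQ _ b ?_ ?_
      · exact ⟨fun _ => rfl, fun h'' => absurd h.symm h''⟩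
      · intro i hi y hy
        rcases (show 1 ≤ i ∨ i = 0 by omega) with hh | rfl
        · rw [hd i hh hi]
          refine ⟨fun h' => ?_, fun h' => ?_⟩
          · rw [hi' i hh hi _ _ h'.symm]; exact hy.1 h'
          · rw [hi' i hh hi _ _ (by rw [hc']; exact z2 _ _ h'.symm)]; exact hy.2 h'
        · rw [hd']
          refine ⟨fun h' => ?_, fun h' => ?_⟩
          · have e := mid (r (n - 1) a) y (by rw [hc']; exact z2 _ _ (z3 _ _ h').symm)
            rw [hP.invol (n - 1) (by omega)] at e
            rw [e, hy.2 (z3 _ _ h')]; exact hP.invol (n - 1) (by omega) _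
          · rw [mid _ _ (z4 _ _ h').symm, hy.1 (z4 _ _ h')]
    exact (this b').1 h'.symm
  have A : ∀ a a' b, c a = d b → c a' = d b → (g (a', b)).2 = (g (a, b)).2 := by
    intro a a' b h h'
    have : ∀ x, (c x = d b → (g (x, b)).2 = (g (a, b)).2) ∧
        (c x ≠ d b → (g (x, s 0 b)).2 = s 0 (g (a, b)).2) := by
      refine poly_ind hP _ a ?_ ?_
      · exact ⟨fun _ => rfl, fun h'' => absurd h h''⟩
      · intro i hi x hx
        rcases (show i < n - 1 ∨ i = n - 1 by omega) with hh | rfl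
        · rw [hc i hh]
          refine ⟨fun h' => ?_, fun h' => ?_⟩
          · rw [lo i hh _ _ h']; exact hx.1 h'
          · rw [lo i hh _ _ (by rw [hd']; exact z1 _ _ h')]; exact hx.2 h'
        · rw [hc']
          refine ⟨fun h' => ?_, fun h' => ?_⟩
          · have e := mid x (s 0 b) (by rw [hd']; exact z1 _ _ (z3 _ _ h'))
            rw [hQ.invol 0 (by omega)] at e
            rw [e, hx.2 (z3 _ _ h')]; exact hQ.invol 0 (by omega) _
          · rw [mid _ _ (z4 _ _ h'), hx.1 (z4 _ _ h')]
    exact (this a').1 h'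
  have E : ∀ a b, c a = d b → g (a, b) = ((g (a, u a)).1, (g (v b, b)).2) := fun a b h =>
    Prod.ext (B a (u a) b (hu a) h) (A (v b) a b (hv b) h)
  refine ⟨fun a => (g (a, u a)).1, fun b => (g (v b, b)).2, ?_, ?_, E⟩
  · intro i hi x
    rcases (show i < n - 1 ∨ i = n - 1 by omega) with hh | rfl
    · have h1 := lo i hh x (u x) (hu x)
      rw [E (r i x) (u x) (by rw [hc i hh]; exact hu x)] at h1
      exact congrArg Prod.fst h1
    · have h1 := mid x (u x) (hu x)
      rw [E (r (n - 1) x) (s 0 (u x)) (by rw [hc', hd', hu x])] at h1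
      exact congrArg Prod.fst h1
  · intro i hi x
    rcases (show 1 ≤ i ∨ i = 0 by omega) with hh | rfl
    · have h1 := hi' i hh hi (v x) x (hv x)
      rw [E (v x) (s i x) (by rw [hd i hh hi]; exact hv x)] at h1
      exact congrArg Prod.snd h1
    · have h1 := mid (v x) x (hv x)
      rw [E (r (n - 1) (v x)) (s 0 x) (by rw [hc', hd', hv x])] at h1
      exact congrArg Prod.snd h1

theorem isAuto_inv {F : Type*} {n : ℕ} {r : ℕ → F → F} {φ : F → F} (h : IsAuto n r φ) :
    ∃ χ, IsAuto n r χ ∧ χ ∘ φ = id ∧ φ ∘ χ = id := by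
  obtain ⟨χ, h1, h2⟩ := Function.bijective_iff_has_inverse.1 h.1
  refine ⟨χ, ⟨Function.bijective_iff_has_inverse.2 ⟨φ, h2, h1⟩, fun i hi x => ?_⟩,
    funext h1, funext h2⟩
  apply h.1.1
  rw [h2, h.2 i hi, h2]

/-- for the flat amalgamation `P|Q` (flag set `M`) of a facet-bipartite
`n`-polytope `P` and a vertex-bipartite `m`-polytope `Q`, the set `H` of pairs
`(φ, ψ) ∈ Γ(P) × Γ(Q)` with `c∘φ + d∘ψ = c + d` is a subgroup of `Γ(P) × Γ(Q)`
(it contains the identity and is closed under composition and inverses); each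
`(φ, ψ) ∈ H` maps `M` into `M` and restricts to an automorphism of `P|Q`; and the
resulting map `H → Γ(P|Q)` is a group isomorphism (it is injective, and every
automorphism of `P|Q` agrees on `M` with `Prod.map φ ψ` for a unique `(φ, ψ) ∈ H`;
it sends composition to composition by construction). -/
theorem flatAmalg_autGroup {F G : Type*} (n m : ℕ) (hn : 2 ≤ n) (hm : 2 ≤ m)
    (r : ℕ → F → F) (hP : IsPolytope n r)
    (c : F → ZMod 2)
    (hc : (∀ i ≤ n - 2, ∀ Λ, c (r i Λ) = c Λ) ∧ (∀ Λ, c (r (n - 1) Λ) = c Λ + 1))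
    (Φ₀ : F) (hΦ₀ : c Φ₀ = 0)
    (s : ℕ → G → G) (hQ : IsPolytope m s)
    (d : G → ZMod 2)
    (hd : (∀ j, 1 ≤ j → j ≤ m - 1 → ∀ Δ, d (s j Δ) = d Δ) ∧ (∀ Δ, d (s 0 Δ) = d Δ + 1))
    (Ψ₀ : G) (hΨ₀ : d Ψ₀ = 0) :
    -- `H` is a subgroup of `Γ(P) × Γ(Q)`:
    ((id, id) ∈ mixH n m r s c d ∧
      (∀ p ∈ mixH n m r s c d, ∀ q ∈ mixH n m r s c d,
        (p.1 ∘ q.1, p.2 ∘ q.2) ∈ mixH n m r s c d) ∧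
      (∀ p ∈ mixH n m r s c d, ∃ q ∈ mixH n m r s c d,
        q.1 ∘ p.1 = id ∧ p.1 ∘ q.1 = id ∧ q.2 ∘ p.2 = id ∧ p.2 ∘ q.2 = id)) ∧
    -- each `(φ, ψ) ∈ H` maps `M` to `M` and restricts to an automorphism of `P|Q`:
    (∀ p ∈ mixH n m r s c d,
      Set.MapsTo (Prod.map p.1 p.2) (mixM n m r s Φ₀ Ψ₀) (mixM n m r s Φ₀ Ψ₀) ∧
      IsAutoOn (m + n - 1) (mixR n r s) (mixM n m r s Φ₀ Ψ₀) (Prod.map p.1 p.2)) ∧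
    -- the resulting map `H → Γ(P|Q)` is injective …
    (∀ p ∈ mixH n m r s c d, ∀ q ∈ mixH n m r s c d,
      (∀ X ∈ mixM n m r s Φ₀ Ψ₀, Prod.map p.1 p.2 X = Prod.map q.1 q.2 X) → p = q) ∧
    -- … and surjective onto `Γ(P|Q)`:
    (∀ g : F × G → F × G, IsAutoOn (m + n - 1) (mixR n r s) (mixM n m r s Φ₀ Ψ₀) g →
      ∃ p ∈ mixH n m r s c d, ∀ X ∈ mixM n m r s Φ₀ Ψ₀, g X = Prod.map p.1 p.2 X) := by
  have hc1 : ∀ i < n - 1, ∀ Λ, c (r i Λ) = c Λ := fun i hi => hc.1 i (by omega)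
  have hd1 : ∀ j, 1 ≤ j → j < m → ∀ Δ, d (s j Δ) = d Δ := fun j h1 h2 => hd.1 j h1 (by omega)
  have hc' := hc.2
  have hd' := hd.2
  have hM := mem_mixM n m hn hm r hP c hc1 hc' Φ₀ hΦ₀ s hQ d hd1 hd' Ψ₀ hΨ₀
  have ex1 : ∀ a, ∃ b, c a = d b := fun a => by
    by_cases h : c a = d Ψ₀
    · exact ⟨_, h⟩
    · exact ⟨s 0 Ψ₀, by rw [hd']; exact z1 _ _ h⟩
  have ex2 : ∀ b, ∃ a, c a = d b := fun b => by
    by_cases h : c Φ₀ = d b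
    · exact ⟨_, h⟩
    · exact ⟨r (n - 1) Φ₀, by rw [hc']; exact z2 _ _ h⟩
  generalize hMM : mixM n m r s Φ₀ Ψ₀ = M at *
  refine ⟨⟨?_, ?_, ?_⟩, ?_, ?_, ?_⟩
  · exact ⟨⟨Function.bijective_id, fun _ _ _ => rfl⟩, ⟨Function.bijective_id, fun _ _ _ => rfl⟩,
      fun _ _ => rfl⟩
  · rintro p ⟨p1, p2, p3⟩ q ⟨q1, q2, q3⟩
    refine ⟨⟨p1.1.comp q1.1, fun i hi x => ?_⟩, ⟨p2.1.comp q2.1, fun i hi x => ?_⟩, fun x y => ?_⟩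
    · simp [q1.2 i hi, p1.2 i hi]
    · simp [q2.2 i hi, p2.2 i hi]
    · simp [p3, q3]
  · rintro p ⟨p1, p2, p3⟩
    obtain ⟨χ, a1, a2, a3⟩ := isAuto_inv p1
    obtain ⟨ξ, b1, b2, b3⟩ := isAuto_inv p2
    refine ⟨(χ, ξ), ⟨a1, b1, fun x y => ?_⟩, a2, a3, b2, b3⟩
    have := p3 (χ x) (ξ y)
    have e1 : p.1 (χ x) = x := congrFun a3 x
    have e2 : p.2 (ξ y) = y := congrFun b3 y
    rw [e1, e2] at this
    exact this.symm
  · rintro ⟨φ, ψ⟩ ⟨p1, p2, p3⟩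
    simp only at p1 p2 p3
    have mt : Set.MapsTo (Prod.map φ ψ) M M := by
      rintro ⟨a, b⟩ h
      rw [hM] at h
      exact (hM _ _).2 ((z5 _ _ _ _ (p3 a b)).2 h)
    refine ⟨mt, ⟨mt, (p1.1.1.prodMap p2.1.1).injOn, ?_⟩, ?_⟩
    · rintro ⟨a, b⟩ h
      obtain ⟨x, rfl⟩ := p1.1.2 a
      obtain ⟨y, rfl⟩ := p2.1.2 b
      rw [hM] at h
      exact ⟨(x, y), (hM _ _).2 ((z5 _ _ _ _ (p3 x y)).1 h), rfl⟩
    · rintro i hi ⟨a, b⟩ -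
      rcases idx_cases hn hi with h | rfl | ⟨j, h1, h2, rfl⟩
      · simp only [mixR_lo r s h, Prod.map_apply, p1.2 i (by omega)]
      · simp only [mixR_mid, Prod.map_apply, p1.2 (n - 1) (by omega), p2.2 0 (by omega)]
      · simp only [mixR_hi hn r s h1, Prod.map_apply, p2.2 j h2]
  · rintro ⟨φ, ψ⟩ - ⟨φ', ψ'⟩ - h
    refine Prod.ext (funext fun a => ?_) (funext fun b => ?_)
    · obtain ⟨b, hb⟩ := ex1 a
      exact congrArg Prod.fst (h (a, b) ((hM _ _).2 hb))
    · obtain ⟨a, hb⟩ := ex2 b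
      exact congrArg Prod.snd (h (a, b) ((hM _ _).2 hb))
  · have split : ∀ g : F × G → F × G,
        (∀ i < m + n - 1, ∀ X ∈ M, g (mixR n r s i X) = mixR n r s i (g X)) →
        ∃ (φ : F → F) (ψ : G → G), (∀ i < n, ∀ x, φ (r i x) = r i (φ x)) ∧
          (∀ i < m, ∀ x, ψ (s i x) = s i (ψ x)) ∧
          ∀ a b, c a = d b → g (a, b) = (φ a, ψ b) := by
      intro g hg
      apply split_core n m hn hm r hP c hc1 hc' s hQ d hd1 hd' ex1 ex2 g
      · intro i hi a b h
        have := hg i (by omega) _ ((hM _ _).2 h)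
        rwa [mixR_lo r s hi, ← Prod.mk.eta (p := g (a, b)), mixR_lo r s hi] at this
      · intro a b h
        have := hg (n - 1) (by omega) _ ((hM _ _).2 h)
        rwa [mixR_mid, ← Prod.mk.eta (p := g (a, b)), mixR_mid] at this
      · intro j h1 h2 a b h
        have := hg (n - 1 + j) (by omega) _ ((hM _ _).2 h)
        rwa [mixR_hi hn r s h1, ← Prod.mk.eta (p := g (a, b)), mixR_hi hn r s h1] at this
    have Mstep : ∀ i < m + n - 1, ∀ X ∈ M, mixR n r s i X ∈ M := by
      subst hMM
      exact fun i hi X hX => Relation.ReflTransGen.tail hX ⟨i, hi, rfl⟩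
    rintro g ⟨gb, gc⟩
    haveI : Nonempty (F × G) := ⟨(Φ₀, Ψ₀)⟩
    have inv := gb.invOn_invFunOn
    have gb' : Set.BijOn (Function.invFunOn g M) M M := gb.symm inv.symm
    obtain ⟨φ, ψ, h1, h2, h3⟩ := split g gc
    obtain ⟨φ', ψ', h1', h2', h3'⟩ := split (Function.invFunOn g M) (by
      intro i hi X hX
      have hY := gb'.mapsTo hX
      apply gb.injOn (gb'.mapsTo (Mstep i hi X hX)) (Mstep i hi _ hY)
      rw [inv.2 (Mstep i hi X hX), gc i hi _ hY, inv.2 hX])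
    have L : ∀ a b, c a = d b → φ' (φ a) = a ∧ ψ' (ψ b) = b := by
      intro a b h
      have hX := (hM _ _).2 h
      have e := inv.1 hX
      have hY := gb.mapsTo hX
      rw [h3 _ _ h] at e hY
      rw [h3' _ _ ((hM _ _).1 hY)] at e
      exact Prod.mk.inj e
    have R : ∀ a b, c a = d b → φ (φ' a) = a ∧ ψ (ψ' b) = b := by
      intro a b h
      have hX := (hM _ _).2 h
      have e := inv.2 hX
      have hY := gb'.mapsTo hX
      rw [h3' _ _ h] at e hY
      rw [h3 _ _ ((hM _ _).1 hY)] at e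
      exact Prod.mk.inj e
    have col : ∀ a b, c a = d b → c (φ a) = d (ψ b) := by
      intro a b h
      have hY := gb.mapsTo ((hM _ _).2 h)
      rw [h3 _ _ h] at hY
      exact (hM _ _).1 hY
    refine ⟨(φ, ψ), ⟨⟨Function.bijective_iff_has_inverse.2 ⟨φ', ?_, ?_⟩, h1⟩,
      ⟨Function.bijective_iff_has_inverse.2 ⟨ψ', ?_, ?_⟩, h2⟩, ?_⟩, ?_⟩
    · exact fun a => (ex1 a).elim fun b h => (L a b h).1
    · exact fun a => (ex1 a).elim fun b h => (R a b h).1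
    · exact fun b => (ex2 b).elim fun a h => (L a b h).2
    · exact fun b => (ex2 b).elim fun a h => (R a b h).2
    · intro a b
      by_cases h : c a = d b
      · rw [z6 _ _ h]; exact z6 _ _ (col a b h)
      · have h' := z2 _ _ h
        have := col (r (n - 1) a) b (by rw [hc']; exact h')
        rw [h1 (n - 1) (by omega), hc'] at this
        exact z7 _ _ _ _ this h'
    · rintro ⟨a, b⟩ h
      exact h3 a b ((hM _ _).1 h)
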